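/- Let N ≥ 2 and 1 < α < N. For every 0 < ε < 1 there exists δ_ε > 0 with the following property: for every measurable set E ⊆ ℝ^N with |E| = ω_N and δ(E) < δ_ε, there exists a measurable set E' ⊆ ℝ^N with |E'| = ω_N such that B(1−ε²) ⊆ E' ⊆ B(1+ε²), D(E') ≤ D(E), and δ(E') = δ(E). -/

import Mathlib

open MeasureTheory Metric
open scoped symmDiff

noncomputable def rieszEnergy (N : ℕ) (α : ℝ) (E : Set (EuclideanSpace ℝ (Fin N))) : ℝ :=
  ∫ x in E, ∫ y in E, ‖y - x‖ ^ (α - (N : ℝ))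

noncomputable def deficit (N : ℕ) (α : ℝ) (E : Set (EuclideanSpace ℝ (Fin N))) : ℝ :=
  rieszEnergy N α (ball (0 : EuclideanSpace ℝ (Fin N)) 1) - rieszEnergy N α E

noncomputable def asymmetry (N : ℕ) (E : Set (EuclideanSpace ℝ (Fin N))) : ℝ :=
  ⨅ x : EuclideanSpace ℝ (Fin N), (volume (ball x 1 ∆ E)).toReal

section

variable {V : Type*} [NormedAddCommGroup V] [InnerProductSpace ℝ V] [FiniteDimensional ℝ V]
  [MeasurableSpace V] [BorelSpace V]

/-- The potential of the set `E` with kernel `‖·‖ ^ p`. -/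
noncomputable def powerPotential (p : ℝ) (E : Set V) (x : V) : ℝ :=
  ∫ y in E, ‖y - x‖ ^ p

theorem measurable_norm_rpow {W : Type*} [NormedAddCommGroup W] [MeasurableSpace W] [BorelSpace W]
    (p : ℝ) : Measurable fun z : W => ‖z‖ ^ p := by fun_prop

theorem integrableOn_ball_norm_rpow [Nontrivial V] {p : ℝ} (hp : -(Module.finrank ℝ V : ℝ) < p)
    (r : ℝ) : IntegrableOn (fun z : V => ‖z‖ ^ p) (ball 0 r) := by
  refine integrableOn_ball_of_norm_le_rpow (C := 1) (α := -p)
    (Module.finrank_pos (R := ℝ) (M := V)) (by linarith) ?_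
    (measurable_norm_rpow p).aestronglyMeasurable
  refine Filter.Eventually.of_forall fun z => ?_
  rw [neg_neg, one_mul, Real.norm_of_nonneg (by positivity)]

theorem lintegral_norm_sub_rpow_le {p : ℝ} (hp0 : p ≤ 0) {A : Set V} (hA : MeasurableSet A)
    (x : V) :
    ∫⁻ y in A, ENNReal.ofReal (‖y - x‖ ^ p) ≤
      (∫⁻ z in (fun z => z + x) ⁻¹' A, (ball (0 : V) 1).indicator
        (fun z => ENNReal.ofReal (‖z‖ ^ p)) z) + volume A := by
  have hm : Measurable fun z : V => ENNReal.ofReal (‖z‖ ^ p) :=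
    (measurable_norm_rpow p).ennreal_ofReal
  have hmp : MeasurePreserving (fun z : V => z + x) volume volume :=
    measurePreserving_add_right volume x
  have h1 : ∫⁻ y in A, ENNReal.ofReal (‖y - x‖ ^ p) =
      ∫⁻ z in (fun z => z + x) ⁻¹' A, ENNReal.ofReal (‖z‖ ^ p) := by
    rw [← hmp.setLIntegral_comp_preimage hA (f := fun y => ENNReal.ofReal (‖y - x‖ ^ p))
      ((measurable_norm_rpow p).comp (measurable_id.sub_const x)).ennreal_ofReal]
    simp
  rw [h1, ← hmp.measure_preimage hA.nullMeasurableSet, ← setLIntegral_one,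
    ← lintegral_add_right _ measurable_const]
  refine lintegral_mono fun z => ?_
  by_cases hz : z ∈ ball (0 : V) 1
  · simp [Set.indicator_of_mem hz]
  · have : 1 ≤ ‖z‖ := by simpa using hz
    rw [Set.indicator_of_notMem hz, zero_add, ← ENNReal.ofReal_one]
    exact ENNReal.ofReal_le_ofReal (Real.rpow_le_one_of_one_le_of_nonpos this hp0)

theorem lintegral_indicator_norm_rpow_ne_top [Nontrivial V] {p : ℝ}
    (hp : -(Module.finrank ℝ V : ℝ) < p) :
    ∫⁻ z, (ball (0 : V) 1).indicator (fun z => ENNReal.ofReal (‖z‖ ^ p)) z ≠ ⊤ := by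
  rw [lintegral_indicator measurableSet_ball]
  exact (integrableOn_ball_norm_rpow hp 1).lintegral_lt_top.ne

theorem exists_lintegral_norm_sub_rpow_le [Nontrivial V] {p : ℝ}
    (hp : -(Module.finrank ℝ V : ℝ) < p) (hp0 : p ≤ 0) {A : Set V} (hA : MeasurableSet A)
    (hAf : volume A ≠ ⊤) :
    ∃ C : ENNReal, C ≠ ⊤ ∧ ∀ x, ∫⁻ y in A, ENNReal.ofReal (‖y - x‖ ^ p) ≤ C :=
  ⟨_, ENNReal.add_ne_top.2 ⟨lintegral_indicator_norm_rpow_ne_top hp, hAf⟩, fun x =>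
    (lintegral_norm_sub_rpow_le hp0 hA x).trans (add_le_add (setLIntegral_le_lintegral _ _) le_rfl)⟩

theorem integrableOn_norm_sub_rpow [Nontrivial V] {p : ℝ}
    (hp : -(Module.finrank ℝ V : ℝ) < p) (hp0 : p ≤ 0) {A : Set V} (hA : MeasurableSet A)
    (hAf : volume A ≠ ⊤) (x : V) : IntegrableOn (fun y => ‖y - x‖ ^ p) A := by
  obtain ⟨C, hC, h⟩ := exists_lintegral_norm_sub_rpow_le hp hp0 hA hAf
  refine ⟨((measurable_norm_rpow p).comp (measurable_id.sub_const x)).aestronglyMeasurable, ?_⟩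
  rw [hasFiniteIntegral_iff_ofReal (Filter.Eventually.of_forall fun y => by positivity)]
  exact (h x).trans_lt hC.lt_top

theorem powerPotential_nonneg (p : ℝ) (E : Set V) (x : V) : 0 ≤ powerPotential p E x :=
  integral_nonneg fun y => by positivity

theorem powerPotential_eq_toReal (p : ℝ) (A : Set V) (x : V) :
    powerPotential p A x = (∫⁻ y in A, ENNReal.ofReal (‖y - x‖ ^ p)).toReal :=
  integral_eq_lintegral_of_nonneg_ae (Filter.Eventually.of_forall fun y => by positivity)
    ((measurable_norm_rpow p).comp (measurable_id.sub_const x)).aestronglyMeasurable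

theorem exists_powerPotential_le [Nontrivial V] {p : ℝ}
    (hp : -(Module.finrank ℝ V : ℝ) < p) (hp0 : p ≤ 0) {A : Set V} (hA : MeasurableSet A)
    (hAf : volume A ≠ ⊤) : ∃ C : ℝ, ∀ x, powerPotential p A x ≤ C := by
  obtain ⟨C, hC, h⟩ := exists_lintegral_norm_sub_rpow_le hp hp0 hA hAf
  exact ⟨C.toReal, fun x => powerPotential_eq_toReal p A x ▸ ENNReal.toReal_mono hC (h x)⟩

theorem exists_powerPotential_le_of_measure_lt [Nontrivial V] {p : ℝ}
    (hp : -(Module.finrank ℝ V : ℝ) < p) (hp0 : p ≤ 0) {κ : ℝ} (hκ : 0 < κ) :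
    ∃ ρ : ℝ, 0 < ρ ∧ ∀ A : Set V, MeasurableSet A → volume A < ENNReal.ofReal ρ →
      ∀ x, powerPotential p A x ≤ κ := by
  obtain ⟨d, hd, h⟩ := exists_pos_setLIntegral_lt_of_measure_lt
    (lintegral_indicator_norm_rpow_ne_top (V := V) hp) (ε := ENNReal.ofReal (κ / 2))
    (by simpa using hκ)
  obtain ⟨d', hd', hd'd⟩ := ENNReal.lt_iff_exists_real_btwn.1 hd
  have hd'0 : 0 < d' := by simpa using hd'd.1
  refine ⟨min d' (κ / 2), by positivity, fun A hA hAv x => ?_⟩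
  have hA1 : volume A < d := hAv.trans_le
    ((ENNReal.ofReal_le_ofReal (min_le_left _ _)).trans hd'd.2.le)
  have hA2 : volume A ≤ ENNReal.ofReal (κ / 2) := hAv.le.trans
    (ENNReal.ofReal_le_ofReal (min_le_right _ _))
  rw [powerPotential_eq_toReal]
  refine ENNReal.toReal_le_of_le_ofReal hκ.le ((lintegral_norm_sub_rpow_le hp0 hA x).trans ?_)
  rw [← add_halves κ, ENNReal.ofReal_add (by positivity) (by positivity)]
  refine add_le_add (h _ ?_).le hA2
  rwa [measure_preimage_add_right]

theorem stronglyMeasurable_powerPotential (p : ℝ) (A : Set V) :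
    StronglyMeasurable (powerPotential p A) := by
  have : Measurable fun q : V × V => ‖q.2 - q.1‖ ^ p :=
    (measurable_norm_rpow p).comp (measurable_snd.sub measurable_fst)
  exact this.stronglyMeasurable.integral_prod_right

theorem integrableOn_powerPotential [Nontrivial V] {p : ℝ}
    (hp : -(Module.finrank ℝ V : ℝ) < p) (hp0 : p ≤ 0) {A B : Set V} (hA : MeasurableSet A)
    (hAf : volume A ≠ ⊤) (hBf : volume B ≠ ⊤) :
    IntegrableOn (powerPotential p A) B := by
  obtain ⟨C, hC⟩ := exists_powerPotential_le hp hp0 hA hAf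
  refine Measure.integrableOn_of_bounded hBf
    (stronglyMeasurable_powerPotential p A).aestronglyMeasurable (M := C) ?_
  refine Filter.Eventually.of_forall fun x => ?_
  rw [Real.norm_of_nonneg (powerPotential_nonneg p A x)]
  exact hC x

theorem setIntegral_powerPotential_comm [Nontrivial V] {p : ℝ}
    (hp : -(Module.finrank ℝ V : ℝ) < p) (hp0 : p ≤ 0) {A B : Set V} (hA : MeasurableSet A)
    (hAf : volume A ≠ ⊤) (hBf : volume B ≠ ⊤) :
    ∫ x in B, powerPotential p A x = ∫ x in A, powerPotential p B x := by
  have hm : Measurable fun q : V × V => ‖q.2 - q.1‖ ^ p :=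
    (measurable_norm_rpow p).comp (measurable_snd.sub measurable_fst)
  have : IsFiniteMeasure (volume.restrict A) := ⟨by simpa using hAf.lt_top⟩
  have : IsFiniteMeasure (volume.restrict B) := ⟨by simpa using hBf.lt_top⟩
  have hint : Integrable (Function.uncurry fun x y : V => ‖y - x‖ ^ p)
      ((volume.restrict B).prod (volume.restrict A)) := by
    refine (integrable_prod_iff hm.aestronglyMeasurable).2 ⟨?_, ?_⟩
    · exact Filter.Eventually.of_forall fun x => integrableOn_norm_sub_rpow hp hp0 hA hAf x
    · refine (integrableOn_powerPotential hp hp0 hA hAf hBf).congr ?_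
      refine Filter.Eventually.of_forall fun x => ?_
      refine integral_congr_ae (Filter.Eventually.of_forall fun y => ?_)
      exact (Real.norm_of_nonneg (by dsimp; positivity)).symm
  unfold powerPotential
  rw [integral_integral_swap hint]
  simp_rw [norm_sub_rev]

theorem powerPotential_le_add_symmDiff [Nontrivial V] {p : ℝ}
    (hp : -(Module.finrank ℝ V : ℝ) < p) (hp0 : p ≤ 0) {A B : Set V} (hA : MeasurableSet A)
    (hB : MeasurableSet B) (hAf : volume A ≠ ⊤) (hBf : volume B ≠ ⊤) (x : V) :
    powerPotential p A x ≤ powerPotential p B x + powerPotential p (A ∆ B) x := by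
  have hD : volume (A ∆ B) ≠ ⊤ :=
    ((measure_mono symmDiff_le_sup).trans_lt (measure_union_lt_top hAf.lt_top hBf.lt_top)).ne
  have hnn (μ : Measure V) : 0 ≤ᵐ[μ] fun y => ‖y - x‖ ^ p :=
    Filter.Eventually.of_forall fun y => by dsimp; positivity
  unfold powerPotential
  rw [← integral_inter_add_sdiff hB (integrableOn_norm_sub_rpow hp hp0 hA hAf x)]
  refine add_le_add ?_ ?_
  · exact setIntegral_mono_set (integrableOn_norm_sub_rpow hp hp0 hB hBf x) (hnn _)
      Set.inter_subset_right.eventuallyLE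
  · exact setIntegral_mono_set (integrableOn_norm_sub_rpow hp hp0 (hA.symmDiff hB) hD x) (hnn _)
      (Set.subset_union_left (s := A \ B) (t := B \ A)).eventuallyLE

/-- Reflection across the perpendicular bisector of `x` and `y`. -/
theorem exists_isometryEquiv_swap {x y : V} (hxy : ‖x‖ ≤ ‖y‖) (hne : x ≠ y) :
    ∃ σ : V ≃ᵢ V, MeasurePreserving σ volume volume ∧ (∀ z, σ (σ z) = z) ∧ σ y = x ∧
      ∀ z, ‖z - x‖ ≤ ‖z - y‖ → ‖z‖ ≤ ‖σ z‖ := by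
  set w := x - y with hw
  have hw0 : w ≠ 0 := sub_ne_zero.2 hne
  have hwn : 0 < ‖w‖ ^ 2 := by positivity
  let R : V ≃ₗᵢ[ℝ] V := (ℝ ∙ w)ᗮ.reflection
  have hRw : R w = -w := Submodule.reflection_orthogonalComplement_singleton_eq_neg w
  have hRR : ∀ z, R (R z) = z := fun z => Submodule.reflection_reflection _ z
  have hσ : ∀ z, (R.toIsometryEquiv.trans (IsometryEquiv.addRight (x - R y))) z
      = R z + (x - R y) := fun z => rfl
  refine ⟨R.toIsometryEquiv.trans (IsometryEquiv.addRight (x - R y)),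
    (measurePreserving_add_right volume (x - R y)).comp R.measurePreserving, ?_, ?_, ?_⟩
  · intro z
    rw [hσ, hσ, map_add, map_sub, hRR, hRR]
    have : R x - R y = -(x - y) := by rw [← map_sub, ← hw, hRw]
    rw [show z + (R x - y) + (x - R y) = z + (R x - R y) + (x - y) by abel, this]
    abel
  · rw [hσ]; abel
  · intro z hz
    have hR : R (z - y) = z - y - (2 * (inner ℝ w (z - y) / ‖w‖ ^ 2)) • w := by
      change (ℝ ∙ w)ᗮ.reflection (z - y) = _
      rw [Submodule.reflection_orthogonal_apply, Submodule.reflection_singleton_apply, mul_smul]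
      simp [two_smul]
    set t : ℝ := 1 - 2 * (inner ℝ w (z - y) / ‖w‖ ^ 2) with ht
    have hσz : R z + (x - R y) = z + t • w := by
      rw [show R z + (x - R y) = R (z - y) + x by rw [map_sub]; abel, hR, ht, sub_smul, one_smul,
        hw]
      abel
    have htw : t * ‖w‖ ^ 2 = ‖w‖ ^ 2 - 2 * inner ℝ w (z - y) := by
      rw [ht]; field_simp
    have h1 : ‖z - x‖ ^ 2 ≤ ‖z - y‖ ^ 2 := by gcongr
    have h2 : ‖z - x‖ ^ 2 = ‖z - y‖ ^ 2 - 2 * inner ℝ w (z - y) + ‖w‖ ^ 2 := by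
      rw [show z - x = (z - y) - w by rw [hw]; abel, norm_sub_sq_real, real_inner_comm]
    have ht0 : t ≤ 0 := by
      by_contra! h
      have := mul_pos h hwn
      linarith
    have h3 : ‖x‖ ^ 2 = ‖y‖ ^ 2 + 2 * inner ℝ w y + ‖w‖ ^ 2 := by
      rw [show x = y + w by rw [hw]; abel, norm_add_sq_real, real_inner_comm]
    have h4 : ‖x‖ ^ 2 ≤ ‖y‖ ^ 2 := by gcongr
    rw [inner_sub_right] at htw
    rw [hσ, hσz]
    refine le_of_sq_le_sq ?_ (norm_nonneg _)
    rw [norm_add_sq_real, inner_smul_right, norm_smul, mul_pow, Real.norm_eq_abs, sq_abs,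
      real_inner_comm w z]
    have h5 : 0 ≤ t * (‖x‖ ^ 2 - ‖y‖ ^ 2) :=
      mul_nonneg_of_nonpos_of_nonpos ht0 (by linarith)
    have h6 : 2 * (t * inner ℝ w z) + t ^ 2 * ‖w‖ ^ 2 = t * (‖x‖ ^ 2 - ‖y‖ ^ 2) := by
      rw [h3]
      linear_combination t * htw
    linarith

theorem powerPotential_ball_le_and_lt_of_norm_lt [Nontrivial V] {p : ℝ}
    (hp : -(Module.finrank ℝ V : ℝ) < p) (hp0 : p < 0) {x y : V} (hxy : ‖x‖ ≤ ‖y‖)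
    (hne : x ≠ y) :
    powerPotential p (ball (0 : V) 1) y ≤ powerPotential p (ball (0 : V) 1) x ∧
      (‖x‖ < ‖y‖ →
        powerPotential p (ball (0 : V) 1) y < powerPotential p (ball (0 : V) 1) x) := by
  obtain ⟨σ, hmp, hinv, hyx, hle⟩ := exists_isometryEquiv_swap hxy hne
  have hxy' : σ x = y := by rw [← hyx, hinv]
  have hd : ∀ z w, ‖σ z - σ w‖ = ‖z - w‖ := fun z w => by
    rw [← dist_eq_norm, ← dist_eq_norm, σ.isometry.dist_eq]
  set g : V → ℝ := fun z => ‖z - x‖ ^ p - ‖z - y‖ ^ p with hg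
  have hσx : ∀ z, ‖σ z - x‖ = ‖z - y‖ := fun z => by
    have := hd z y
    rwa [hyx] at this
  have hσy : ∀ z, ‖σ z - y‖ = ‖z - x‖ := fun z => by
    have := hd z x
    rwa [hxy'] at this
  have hgσ : ∀ z, g (σ z) = -g z := fun z => by
    simp only [hg, hσx, hσy]; ring
  set B : Set V := ball 0 1 with hB
  have hBm : MeasurableSet B := measurableSet_ball
  have hBf : volume B ≠ ⊤ := measure_ball_lt_top.ne
  have hσm : Measurable σ := σ.continuous.measurable
  have hB'm : MeasurableSet (σ ⁻¹' B) := hσm hBm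
  have hix := integrableOn_norm_sub_rpow hp hp0.le hBm hBf x
  have hiy := integrableOn_norm_sub_rpow hp hp0.le hBm hBf y
  have hgi : IntegrableOn g B := hix.sub hiy
  have hzero : ∫ z in B ∩ σ ⁻¹' B, g z = 0 := by
    have h1 := hmp.setIntegral_preimage_emb σ.toHomeomorph.measurableEmbedding g (B ∩ σ ⁻¹' B)
    have h2 : σ ⁻¹' (B ∩ σ ⁻¹' B) = B ∩ σ ⁻¹' B := by
      ext z
      simp [hinv, and_comm]
    rw [h2] at h1
    simp_rw [hgσ, integral_neg] at h1
    linarith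
  have hdiff : powerPotential p B x - powerPotential p B y = ∫ z in B \ σ ⁻¹' B, g z := by
    unfold powerPotential
    rw [← integral_sub hix hiy, ← integral_inter_add_sdiff hB'm hgi, hzero, zero_add]
  have hlt : ∀ z ∈ B \ σ ⁻¹' B, ‖z - x‖ < ‖z - y‖ := by
    intro z ⟨hz1, hz2⟩
    by_contra! h
    have h1 : ‖z‖ < 1 := by simpa [hB] using hz1
    have h2 : 1 ≤ ‖σ z‖ := by rwa [Set.mem_preimage, hB, mem_ball_zero_iff, not_lt] at hz2
    have h3 := hle (σ z) (by rwa [hσx, hσy])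
    rw [hinv] at h3
    linarith
  have hpos : ∀ z ∈ B \ σ ⁻¹' B, z ≠ x → 0 < g z := fun z hz hzx =>
    sub_pos.2 (Real.rpow_lt_rpow_of_neg (norm_pos_iff.2 (sub_ne_zero.2 hzx)) (hlt z hz) hp0)
  have hnn : 0 ≤ᵐ[volume.restrict (B \ σ ⁻¹' B)] g := by
    rw [Filter.EventuallyLE, ae_restrict_iff' (hBm.diff hB'm)]
    filter_upwards [compl_mem_ae_iff.2 (measure_singleton (μ := (volume : Measure V)) x)]
      with z hzx hz
    exact (hpos z hz hzx).le
  refine ⟨?_, fun hlt' => ?_⟩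
  · rw [← sub_nonneg, hdiff]
    exact integral_nonneg_of_ae hnn
  · rw [← sub_pos, hdiff, setIntegral_pos_iff_support_of_nonneg_ae hnn
      (hgi.mono_set Set.sdiff_subset)]
    set s := σ 0 with hs
    have hs0 : s ≠ 0 := by
      intro h
      have := hd y 0
      rw [← hs, h, hyx, sub_zero, sub_zero] at this
      linarith
    have hsp : 0 < ‖s‖ := norm_pos_iff.2 hs0
    let U : Set V := {z | ‖z‖ < 1 ∧ 1 < ‖σ z‖} \ {x}
    have hUo : IsOpen {z : V | ‖z‖ < 1 ∧ 1 < ‖σ z‖} :=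
      (isOpen_lt continuous_norm continuous_const).inter
        (isOpen_lt continuous_const σ.continuous.norm)
    have hUne : {z : V | ‖z‖ < 1 ∧ 1 < ‖σ z‖}.Nonempty := by
      obtain ⟨r, hr0, hr1⟩ := exists_between (max_lt one_pos (sub_lt_self 1 hsp))
      have hr2 := (le_max_left _ _).trans_lt hr0
      have hr3 := (le_max_right _ _).trans_lt hr0
      refine ⟨(-(r / ‖s‖)) • s, ?_, ?_⟩
      · rw [norm_smul, norm_neg, Real.norm_of_nonneg (by positivity)]
        field_simp
        exact hr1
      · have h0 : σ s = 0 := hinv 0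
        rw [← sub_zero (σ _), ← h0, hd,
          show (-(r / ‖s‖)) • s - s = (-(r / ‖s‖ + 1)) • s by module,
          norm_smul, norm_neg, Real.norm_of_nonneg (by positivity), add_mul]
        field_simp
        linarith
    have hUsub : U ⊆ Function.support g ∩ (B \ σ ⁻¹' B) := by
      intro z ⟨⟨hz1, hz2⟩, hzx⟩
      have hz : z ∈ B \ σ ⁻¹' B := ⟨by simpa [hB] using hz1, by
        rw [Set.mem_preimage, hB, mem_ball_zero_iff, not_lt]; exact hz2.le⟩
      exact ⟨(hpos z hz hzx).ne', hz⟩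
    refine lt_of_lt_of_le ?_ (measure_mono hUsub)
    rw [measure_sdiff_null (measure_singleton x)]
    exact hUo.measure_pos volume hUne

theorem powerPotential_ball_anti [Nontrivial V] {p : ℝ}
    (hp : -(Module.finrank ℝ V : ℝ) < p) (hp0 : p < 0) {x y : V} (hxy : ‖x‖ ≤ ‖y‖) :
    powerPotential p (ball (0 : V) 1) y ≤ powerPotential p (ball (0 : V) 1) x := by
  rcases eq_or_ne x y with rfl | hne
  · exact le_rfl
  · exact (powerPotential_ball_le_and_lt_of_norm_lt hp hp0 hxy hne).1

theorem powerPotential_ball_strictAnti [Nontrivial V] {p : ℝ}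
    (hp : -(Module.finrank ℝ V : ℝ) < p) (hp0 : p < 0) {x y : V} (hxy : ‖x‖ < ‖y‖) :
    powerPotential p (ball (0 : V) 1) y < powerPotential p (ball (0 : V) 1) x :=
  (powerPotential_ball_le_and_lt_of_norm_lt hp hp0 hxy.le (by rintro rfl; exact lt_irrefl _ hxy)).2 hxy

theorem setIntegral_powerPotential_sub [Nontrivial V] {p : ℝ}
    (hp : -(Module.finrank ℝ V : ℝ) < p) (hp0 : p ≤ 0) {E F : Set V} (hE : MeasurableSet E)
    (hF : MeasurableSet F) (hEf : volume E ≠ ⊤) (hFf : volume F ≠ ⊤) :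
    (∫ x in F, powerPotential p F x) - ∫ x in E, powerPotential p E x =
      (∫ x in F \ E, (powerPotential p E x + powerPotential p F x)) -
        ∫ x in E \ F, (powerPotential p E x + powerPotential p F x) := by
  have hi : ∀ {A B : Set V}, MeasurableSet A → volume A ≠ ⊤ → volume B ≠ ⊤ →
      IntegrableOn (powerPotential p A) B := fun hA hAf hBf =>
    integrableOn_powerPotential hp hp0 hA hAf hBf
  have hv : ∀ {B : Set V}, volume B ≠ ⊤ →
      IntegrableOn (fun x => powerPotential p E x + powerPotential p F x) B := fun hBf =>
    (hi hE hEf hBf).add (hi hF hFf hBf)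
  have h1 := integral_inter_add_sdiff hE (hv hFf)
  have h2 := integral_inter_add_sdiff hF (hv hEf)
  rw [integral_add (hi hE hEf hFf) (hi hF hFf hFf)] at h1
  rw [integral_add (hi hE hEf hEf) (hi hF hFf hEf), Set.inter_comm] at h2
  have h3 := setIntegral_powerPotential_comm hp hp0 hE hEf hFf
  linarith

theorem setIntegral_le_setIntegral_of_le_of_ge {v : V → ℝ} {P H : Set V} {c : ℝ}
    (hP : MeasurableSet P) (hH : MeasurableSet H) (hPf : volume P ≠ ⊤) (hHf : volume H ≠ ⊤)
    (hvP : IntegrableOn v P) (hvH : IntegrableOn v H) (hPH : volume.real P = volume.real H)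
    (hle : ∀ x ∈ P, v x ≤ c) (hge : ∀ x ∈ H, c ≤ v x) :
    ∫ x in P, v x ≤ ∫ x in H, v x := by
  calc ∫ x in P, v x ≤ ∫ _ in P, c :=
        setIntegral_mono_on hvP (integrableOn_const hPf) hP hle
    _ = ∫ _ in H, c := by simp [hPH]
    _ ≤ ∫ x in H, v x := setIntegral_mono_on (integrableOn_const hHf) hvH hH hge

theorem volume_real_ball_sdiff_ball [Nontrivial V] {r s : ℝ} (hr : 0 ≤ r) (hrs : r ≤ s) :
    volume.real (ball (0 : V) s \ ball 0 r) =
      (s ^ Module.finrank ℝ V - r ^ Module.finrank ℝ V) * volume.real (ball (0 : V) 1) := by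
  have h : ∀ t : ℝ, 0 ≤ t → volume.real (ball (0 : V) t) =
      t ^ Module.finrank ℝ V * volume.real (ball (0 : V) 1) := fun t ht => by
    rw [measureReal_def, Measure.addHaar_ball _ _ ht, ENNReal.toReal_mul,
      ENNReal.toReal_ofReal (by positivity), measureReal_def]
  rw [measureReal_sdiff (ball_subset_ball hrs) measurableSet_ball measure_ball_lt_top.ne,
    h r hr, h s (hr.trans hrs)]
  ring

theorem volume_real_ball_sdiff_ball_pos [Nontrivial V] {r s : ℝ} (hr : 0 ≤ r) (hrs : r < s) :
    0 < volume.real (ball (0 : V) s \ ball 0 r) := by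
  rw [volume_real_ball_sdiff_ball hr hrs.le]
  have h1 : 0 < volume.real (ball (0 : V) 1) :=
    ENNReal.toReal_pos (measure_ball_pos _ _ one_pos).ne' measure_ball_lt_top.ne
  have h2 := pow_lt_pow_left₀ hrs hr (Module.finrank_pos (R := ℝ) (M := V)).ne'
  exact mul_pos (sub_pos.2 h2) h1

theorem exists_measurableSet_subset_volume_real_eq [Nontrivial V] {A : Set V}
    (hA : MeasurableSet A) {R : ℝ} (hR : 0 ≤ R) (hAR : A ⊆ ball 0 R) {m : ℝ} (hm : 0 ≤ m)
    (hmA : m ≤ volume.real A) :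
    ∃ P ⊆ A, MeasurableSet P ∧ volume.real P = m := by
  set n := Module.finrank ℝ V
  set b := volume.real (ball (0 : V) 1)
  set f : ℝ → ℝ := fun r => volume.real (A ∩ ball 0 r)
  have hff : ∀ r, volume (A ∩ ball 0 r) ≠ ⊤ := fun r =>
    ((measure_mono Set.inter_subset_right).trans_lt measure_ball_lt_top).ne
  have hmono : ∀ r s, r ≤ s → f r ≤ f s := fun r s hrs =>
    measureReal_mono (Set.inter_subset_inter_right _ (ball_subset_ball hrs)) (hff s)
  have hdiff : ∀ r s, 0 ≤ r → r ≤ s → f s - f r ≤ s ^ n * b - r ^ n * b := by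
    intro r s hr hrs
    rw [← sub_mul, ← volume_real_ball_sdiff_ball hr hrs, sub_le_iff_le_add']
    have hDf : volume (ball (0 : V) s \ ball 0 r) ≠ ⊤ :=
      ((measure_mono Set.sdiff_subset).trans_lt measure_ball_lt_top).ne
    refine (measureReal_mono ?_ (measure_union_lt_top (hff r).lt_top hDf.lt_top).ne).trans
      (measureReal_union_le _ _)
    intro z ⟨hz1, hz2⟩
    by_cases hz : z ∈ ball (0 : V) r
    · exact Or.inl ⟨hz1, hz⟩
    · exact Or.inr ⟨hz2, hz⟩
  have hg : Continuous fun r : ℝ => r ^ n * b := by fun_prop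
  have hcont : ContinuousOn f (Set.Icc 0 R) := by
    rw [Metric.continuousOn_iff]
    intro r hr δ hδ
    obtain ⟨τ, hτ, h⟩ := Metric.continuous_iff.1 hg r δ hδ
    refine ⟨τ, hτ, fun s hs hsr => lt_of_le_of_lt ?_ (h s hsr)⟩
    rw [Real.dist_eq, Real.dist_eq]
    rcases le_total r s with hrs | hrs
    · rw [abs_of_nonneg (sub_nonneg.2 (hmono r s hrs))]
      exact (hdiff r s hr.1 hrs).trans (le_abs_self _)
    · rw [abs_sub_comm, abs_of_nonneg (sub_nonneg.2 (hmono s r hrs)), abs_sub_comm]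
      exact (hdiff s r hs.1 hrs).trans (le_abs_self _)
  have h0 : f 0 = 0 := by simp [f]
  have hR' : f R = volume.real A := by simp only [f]; rw [Set.inter_eq_left.2 hAR]
  obtain ⟨r, -, hr⟩ := intermediate_value_Icc hR hcont ⟨h0.trans_le hm, hmA.trans hR'.ge⟩
  exact ⟨A ∩ ball 0 r, Set.inter_subset_left, hA.inter measurableSet_ball, hr⟩

theorem exists_le_volume_real_ball_symmDiff [Nontrivial V] {η : ℝ} (hη : 0 < η) (hη1 : η ≤ 4) :
    ∃ c : ℝ, 0 < c ∧ ∀ x : V, η ≤ ‖x‖ → c ≤ volume.real (ball x 1 ∆ ball (0 : V) 1) := by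
  refine ⟨volume.real (ball (0 : V) (η / 4)),
    ENNReal.toReal_pos (measure_ball_pos _ _ (by positivity)).ne' measure_ball_lt_top.ne,
    fun x hx => ?_⟩
  have hx0 : 0 < ‖x‖ := hη.trans_le hx
  set q : V := ((‖x‖ + (1 - η / 4)) / ‖x‖) • x with hq
  have hqn : ‖q‖ = ‖x‖ + (1 - η / 4) := by
    rw [hq, norm_smul, Real.norm_of_nonneg (div_nonneg (by linarith) hx0.le)]
    field_simp
  have hqx : dist q x = 1 - η / 4 := by
    rw [dist_eq_norm, hq, show ((‖x‖ + (1 - η / 4)) / ‖x‖) • x - x = ((1 - η / 4) / ‖x‖) • x by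
      rw [add_div, div_self hx0.ne', add_smul, one_smul, add_sub_cancel_left],
      norm_smul, Real.norm_of_nonneg (div_nonneg (by linarith) hx0.le)]
    field_simp
  rw [← Measure.addHaar_real_ball_center volume q]
  refine measureReal_mono (fun z hz => Or.inl ⟨?_, ?_⟩)
    ((measure_mono symmDiff_le_sup).trans_lt
      (measure_union_lt_top measure_ball_lt_top measure_ball_lt_top)).ne
  · have := dist_triangle z q x
    rw [mem_ball] at hz ⊢
    linarith
  · rw [mem_ball, dist_eq_norm] at hz
    rw [mem_ball_zero_iff, not_lt]
    have := norm_sub_norm_le q z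
    rw [norm_sub_rev] at this
    linarith

theorem volume_real_symmDiff_eq {X E : Set V} (hX : MeasurableSet X) (hE : MeasurableSet E)
    (hXf : volume X ≠ ⊤) (hEf : volume E ≠ ⊤) :
    volume.real (X ∆ E) = volume.real X + volume.real E - 2 * volume.real (X ∩ E) := by
  have h1 := measureReal_inter_add_sdiff (μ := volume) (s := X) hE hXf
  have h2 := measureReal_inter_add_sdiff (μ := volume) (s := E) hX hEf
  have h3 := measureReal_symmDiff_eq (μ := volume) hX hE hXf hEf
  rw [Set.inter_comm] at h2
  linarith

theorem volume_real_inter_sdiff_union {X E P H : Set V} (hX : MeasurableSet X)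
    (hP : MeasurableSet P) (hH : MeasurableSet H) (hEf : volume E ≠ ⊤) (hHf : volume H ≠ ⊤)
    (hPE : P ⊆ E) (hHE : Disjoint H E)
    (hPH : volume.real (X ∩ P) = volume.real (X ∩ H)) :
    volume.real (X ∩ (E \ P ∪ H)) = volume.real (X ∩ E) := by
  have hXE : volume (X ∩ E) ≠ ⊤ := ((measure_mono Set.inter_subset_right).trans_lt hEf.lt_top).ne
  have hXH : volume (X ∩ H) ≠ ⊤ := ((measure_mono Set.inter_subset_right).trans_lt hHf.lt_top).ne
  have hXEP : volume (X ∩ (E \ P)) ≠ ⊤ :=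
    ((measure_mono (Set.inter_subset_right.trans Set.sdiff_subset)).trans_lt hEf.lt_top).ne
  rw [Set.inter_union_distrib_left, measureReal_union ?_ (hX.inter hH) hXEP hXH,
    ← measureReal_inter_add_sdiff (μ := volume) (s := X ∩ E) hP hXE, ← hPH, Set.inter_assoc,
    Set.inter_eq_right.2 hPE, Set.inter_sdiff_assoc, add_comm]
  exact (hHE.symm.mono_left Set.sdiff_subset).mono Set.inter_subset_right Set.inter_subset_right

theorem iInf_volume_real_symmDiff_le {E F : Set V} {η : ℝ}
    (hη : ∀ x : V, ‖x‖ < η → volume.real (ball x 1 ∆ F) = volume.real (ball x 1 ∆ E))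
    (hη' : ∀ x : V, η ≤ ‖x‖ → volume.real (ball (0 : V) 1 ∆ F) ≤ volume.real (ball x 1 ∆ E)) :
    ⨅ x : V, volume.real (ball x 1 ∆ F) ≤ ⨅ x : V, volume.real (ball x 1 ∆ E) := by
  have hb : BddBelow (Set.range fun x : V => volume.real (ball x 1 ∆ F)) :=
    ⟨0, by rintro _ ⟨x, rfl⟩; exact measureReal_nonneg⟩
  refine le_ciInf fun x => ?_
  rcases lt_or_ge ‖x‖ η with hx | hx
  · exact (ciInf_le hb x).trans (hη x hx).le
  · exact (ciInf_le hb 0).trans (hη' x hx)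

theorem exists_uniformly_close_modification [Nontrivial V] {p : ℝ}
    (hp : -(Module.finrank ℝ V : ℝ) < p) (hp0 : p < 0) {e : ℝ} (he : 0 < e) (he1 : e < 1) :
    ∃ d : ℝ, 0 < d ∧ ∀ E : Set V, MeasurableSet E → volume E = volume (ball (0 : V) 1) →
      volume.real (ball (0 : V) 1 ∆ E) < d →
      ∃ F : Set V, MeasurableSet F ∧ volume F = volume (ball (0 : V) 1) ∧
        ball 0 (1 - e) ⊆ F ∧ F ⊆ ball 0 (1 + e) ∧
        ∫ x in E, powerPotential p E x ≤ ∫ x in F, powerPotential p F x ∧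
        ⨅ x : V, volume.real (ball x 1 ∆ F) = ⨅ x : V, volume.real (ball x 1 ∆ E) := by
  obtain ⟨e₀, he₀⟩ := exists_norm_eq V (zero_le_one (α := ℝ))
  set B : Set V := ball 0 1 with hB
  set u := powerPotential p B with hu
  have hnorm : ∀ t : ℝ, 0 ≤ t → ‖t • e₀‖ = t := fun t ht => by
    rw [norm_smul, he₀, mul_one, Real.norm_of_nonneg ht]
  have hgap : ∀ s t : ℝ, 0 ≤ s → s < t → u (t • e₀) < u (s • e₀) := fun s t hs hst =>
    powerPotential_ball_strictAnti hp hp0 (by rwa [hnorm s hs, hnorm t (hs.trans hst.le)])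
  have hge : ∀ s : ℝ, 0 ≤ s → ∀ x, ‖x‖ ≤ s → u (s • e₀) ≤ u x := fun s hs x hx =>
    powerPotential_ball_anti hp hp0 (by rwa [hnorm s hs])
  have hle : ∀ s : ℝ, 0 ≤ s → ∀ x, s ≤ ‖x‖ → u x ≤ u (s • e₀) := fun s hs x hx =>
    powerPotential_ball_anti hp hp0 (by rwa [hnorm s hs])
  have hgap1 := hgap (1 - e) (1 - e / 2) (by linarith) (by linarith)
  have hgap2 := hgap (1 + e / 2) (1 + e) (by linarith) (by linarith)
  obtain ⟨κ, hκ, hκ'⟩ := exists_between (lt_min (sub_pos.2 hgap1) (sub_pos.2 hgap2))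
  have hκ1 := hκ'.trans_le (min_le_left _ _)
  have hκ2 := hκ'.trans_le (min_le_right _ _)
  obtain ⟨ρ, hρ, hpot⟩ := exists_powerPotential_le_of_measure_lt (V := V) hp hp0.le
    (half_pos hκ)
  obtain ⟨c, hc, hcx⟩ := exists_le_volume_real_ball_symmDiff (V := V) (η := e / 4)
    (by linarith) (by linarith)
  set T : Set V := ball 0 (1 - e / 4) \ ball 0 (1 - e / 2) with hT
  set S : Set V := ball 0 (1 + e / 2) \ ball 0 (1 + e / 4) with hS
  have hTpos : 0 < volume.real T :=
    volume_real_ball_sdiff_ball_pos (by linarith) (by linarith)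
  have hSpos : 0 < volume.real S :=
    volume_real_ball_sdiff_ball_pos (by linarith) (by linarith)
  refine ⟨min (min ρ (c / 2)) (min (volume.real T / 2) (volume.real S / 2)), by positivity, ?_⟩
  intro E hE hEv hEd
  simp only [lt_min_iff] at hEd
  obtain ⟨⟨hEρ, hEc⟩, hET, hES⟩ := hEd
  have hBm : MeasurableSet B := measurableSet_ball
  have hBf : volume B ≠ ⊤ := measure_ball_lt_top.ne
  have hEf : volume E ≠ ⊤ := hEv ▸ hBf
  have hDf : volume (B ∆ E) ≠ ⊤ :=
    ((measure_mono symmDiff_le_sup).trans_lt (measure_union_lt_top hBf.lt_top hEf.lt_top)).ne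
  have hTm : MeasurableSet T := measurableSet_ball.diff measurableSet_ball
  have hSm : MeasurableSet S := measurableSet_ball.diff measurableSet_ball
  have hTf : volume T ≠ ⊤ := ((measure_mono Set.sdiff_subset).trans_lt measure_ball_lt_top).ne
  have hSf : volume S ≠ ⊤ := ((measure_mono Set.sdiff_subset).trans_lt measure_ball_lt_top).ne
  have hTB : T ⊆ B := Set.sdiff_subset.trans (ball_subset_ball (by linarith))
  have hSB : ∀ z ∈ S, z ∉ B := fun z hz hzB => hz.2 (ball_subset_ball (by linarith) hzB)
  set G : Set V := E \ ball 0 (1 + e) with hG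
  set H : Set V := ball 0 (1 - e) \ E with hH
  have hGm : MeasurableSet G := hE.diff measurableSet_ball
  have hHm : MeasurableSet H := measurableSet_ball.diff hE
  have hGD : volume.real G ≤ volume.real (B ∆ E) := measureReal_mono
    (fun z hz => Or.inr ⟨hz.1, fun hzB => hz.2 (ball_subset_ball (by linarith) hzB)⟩) hDf
  have hHD : volume.real H ≤ volume.real (B ∆ E) := measureReal_mono
    (fun z hz => Or.inl ⟨ball_subset_ball (by linarith) hz.1, hz.2⟩) hDf
  have hTE : volume.real H ≤ volume.real (T ∩ E) := by
    have h1 : volume.real (T \ E) ≤ volume.real (B ∆ E) := measureReal_mono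
      (fun z hz => Or.inl ⟨hTB hz.1, hz.2⟩) hDf
    have h2 := measureReal_inter_add_sdiff (μ := volume) (s := T) hE hTf
    linarith
  have hSE : volume.real G ≤ volume.real (S \ E) := by
    have h1 : volume.real (S ∩ E) ≤ volume.real (B ∆ E) := measureReal_mono
      (fun z hz => Or.inr ⟨hz.2, hSB z hz.1⟩) hDf
    have h2 := measureReal_inter_add_sdiff (μ := volume) (s := S) hE hSf
    linarith
  obtain ⟨P, hPsub, hPm, hPH⟩ := exists_measurableSet_subset_volume_real_eq (hTm.inter hE)
    zero_le_two ((Set.inter_subset_left.trans hTB).trans (ball_subset_ball one_le_two))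
    measureReal_nonneg hTE
  obtain ⟨Q, hQsub, hQm, hQG⟩ := exists_measurableSet_subset_volume_real_eq (hSm.diff hE)
    zero_le_two ((Set.sdiff_subset.trans Set.sdiff_subset).trans (ball_subset_ball (by linarith)))
    measureReal_nonneg hSE
  have hGE : G ⊆ E := Set.sdiff_subset
  have hPE : P ⊆ E := hPsub.trans Set.inter_subset_right
  have hHE : Disjoint H E := Set.disjoint_sdiff_left
  have hQE : Disjoint Q E := Set.disjoint_sdiff_left.mono_left hQsub
  have hPn : ∀ z ∈ P, 1 - e / 2 ≤ ‖z‖ ∧ ‖z‖ < 1 - e / 4 := fun z hz => by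
    simpa [hT, and_comm] using (hPsub hz).1
  have hQn : ∀ z ∈ Q, 1 + e / 4 ≤ ‖z‖ ∧ ‖z‖ < 1 + e / 2 := fun z hz => by
    simpa [hS, and_comm] using (hQsub hz).1
  have hGn : ∀ z ∈ G, 1 + e ≤ ‖z‖ := fun z hz => by simpa using hz.2
  have hHn : ∀ z ∈ H, ‖z‖ < 1 - e := fun z hz => by simpa using hz.1
  have hGP : Disjoint G P := Set.disjoint_left.2 fun z hz hz' => by
    linarith [hGn z hz, (hPn z hz').2]
  have hHQ : Disjoint H Q := Set.disjoint_left.2 fun z hz hz' => by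
    linarith [hHn z hz, (hQn z hz').1]
  have hGf : volume G ≠ ⊤ := ((measure_mono hGE).trans_lt hEf.lt_top).ne
  have hPf : volume P ≠ ⊤ := ((measure_mono hPE).trans_lt hEf.lt_top).ne
  have hHf : volume H ≠ ⊤ := ((measure_mono Set.sdiff_subset).trans_lt measure_ball_lt_top).ne
  have hQf : volume Q ≠ ⊤ :=
    ((measure_mono (hQsub.trans Set.sdiff_subset)).trans_lt hSf.lt_top).ne
  have hout : G ∪ P ⊆ E := Set.union_subset hGE hPE
  have hin : Disjoint (H ∪ Q) E := Set.disjoint_union_left.2 ⟨hHE, hQE⟩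
  have hinf : volume (H ∪ Q) ≠ ⊤ := (measure_union_lt_top hHf.lt_top hQf.lt_top).ne
  set F : Set V := E \ (G ∪ P) ∪ (H ∪ Q) with hF
  have hFm : MeasurableSet F := (hE.diff (hGm.union hPm)).union (hHm.union hQm)
  have hFf : volume F ≠ ⊤ :=
    (measure_union_lt_top ((measure_mono Set.sdiff_subset).trans_lt hEf.lt_top) hinf.lt_top).ne
  have hinter : ∀ X : Set V, MeasurableSet X →
      volume.real (X ∩ (G ∪ P)) = volume.real (X ∩ (H ∪ Q)) →
      volume.real (X ∩ F) = volume.real (X ∩ E) := fun X hX h =>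
    volume_real_inter_sdiff_union hX (hGm.union hPm) (hHm.union hQm) hEf hinf hout hin h
  have hFE : volume.real F = volume.real E := by
    have := hinter Set.univ MeasurableSet.univ (by
      rw [Set.univ_inter, Set.univ_inter, measureReal_union hGP hPm hGf hPf,
        measureReal_union hHQ hQm hHf hQf, hPH, hQG, add_comm])
    rwa [Set.univ_inter, Set.univ_inter] at this
  have hsymm : ∀ x : V, ‖x‖ < e / 4 →
      volume.real (ball x 1 ∆ F) = volume.real (ball x 1 ∆ E) := by
    intro x hx
    have hlow : ∀ z : V, ‖z‖ < 1 - e / 4 → z ∈ ball x 1 := fun z hz => by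
      rw [mem_ball, dist_eq_norm]
      linarith [norm_sub_le z x]
    have hupp : ∀ z ∈ ball x 1, ‖z‖ < 1 + e / 4 := fun z hz => by
      rw [mem_ball, dist_eq_norm] at hz
      linarith [norm_sub_norm_le z x]
    have h1 : ball x 1 ∩ (G ∪ P) = P := by
      ext z
      refine ⟨fun ⟨hz, hz'⟩ => hz'.resolve_left fun hzG => ?_, fun hz =>
        ⟨hlow z (hPn z hz).2, Or.inr hz⟩⟩
      linarith [hGn z hzG, hupp z hz]
    have h2 : ball x 1 ∩ (H ∪ Q) = H := by
      ext z
      refine ⟨fun ⟨hz, hz'⟩ => hz'.resolve_right fun hzQ => ?_, fun hz =>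
        ⟨hlow z (by linarith [hHn z hz]), Or.inl hz⟩⟩
      linarith [(hQn z hzQ).1, hupp z hz]
    rw [volume_real_symmDiff_eq measurableSet_ball hFm measure_ball_lt_top.ne hFf,
      volume_real_symmDiff_eq measurableSet_ball hE measure_ball_lt_top.ne hEf, hFE,
      hinter _ measurableSet_ball (by rw [h1, h2, hPH])]
  have hBF : volume.real (B ∆ F) = volume.real (B ∆ E) := hsymm 0 (by simpa using he)
  have hfar : ∀ K : Set V, MeasurableSet K → volume K ≠ ⊤ →
      volume.real (B ∆ K) = volume.real (B ∆ E) → ∀ x : V, e / 4 ≤ ‖x‖ →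
      volume.real (B ∆ E) ≤ volume.real (ball x 1 ∆ K) := by
    intro K hK hKf hBK x hx
    have h1 := hcx x hx
    have h2 := measureReal_symmDiff_le (μ := volume) (s := ball x 1) (t := K) B
      measure_ball_lt_top.ne hKf
    rw [symmDiff_comm K B, hBK] at h2
    linarith
  have hpotE : ∀ K : Set V, MeasurableSet K → volume K ≠ ⊤ →
      volume.real (B ∆ K) = volume.real (B ∆ E) → ∀ x,
      u x - κ / 2 ≤ powerPotential p K x ∧ powerPotential p K x ≤ u x + κ / 2 := by
    intro K hK hKf hBK x
    have hlt : volume (B ∆ K) < ENNReal.ofReal ρ := by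
      rw [ENNReal.lt_ofReal_iff_toReal_lt ((measure_mono symmDiff_le_sup).trans_lt
        (measure_union_lt_top hBf.lt_top hKf.lt_top)).ne, ← measureReal_def, hBK]
      exact hEρ
    have h1 := hpot (B ∆ K) (hBm.symmDiff hK) hlt x
    have h2 := powerPotential_le_add_symmDiff hp hp0.le hBm hK hBf hKf x
    have h3 := powerPotential_le_add_symmDiff hp hp0.le hK hBm hKf hBf x
    rw [symmDiff_comm K B] at h3
    constructor <;> linarith
  refine ⟨F, hFm, ?_, ?_, ?_, ?_, le_antisymm ?_ ?_⟩
  · rw [← hEv]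
    exact (measureReal_eq_measureReal_iff hFf hEf).1 hFE
  · intro z hz
    by_cases hzE : z ∈ E
    · have hz' : ‖z‖ < 1 - e := by simpa using hz
      refine Or.inl ⟨hzE, ?_⟩
      rintro (h | h)
      · linarith [hGn z h]
      · linarith [(hPn z h).1]
    · exact Or.inr (Or.inl ⟨hz, hzE⟩)
  · rintro z (⟨hz, hz'⟩ | hz | hz)
    · by_contra h
      exact hz' (Or.inl ⟨hz, h⟩)
    · rw [mem_ball_zero_iff]
      linarith [hHn z hz]
    · rw [mem_ball_zero_iff]
      linarith [(hQn z hz).2]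
  · rw [← sub_nonneg, setIntegral_powerPotential_sub hp hp0.le hE hFm hEf hFf]
    have hFdE : F \ E = H ∪ Q := by
      rw [hF, Set.union_sdiff_distrib, Set.sdiff_eq_empty.2 Set.sdiff_subset, Set.empty_union,
        hin.sdiff_eq_left]
    have hEdF : E \ F = G ∪ P := by
      rw [hF, ← Set.sdiff_sdiff, Set.sdiff_sdiff_cancel_left hout]
      exact (hin.symm.mono_left hout).sdiff_eq_left
    set v : V → ℝ := fun x => powerPotential p E x + powerPotential p F x with hv
    have hvi : ∀ {A : Set V}, volume A ≠ ⊤ → IntegrableOn v A := fun hA =>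
      (integrableOn_powerPotential hp hp0.le hE hEf hA).add
        (integrableOn_powerPotential hp hp0.le hFm hFf hA)
    have hvl : ∀ x, 2 * u x - κ ≤ v x := fun x => by
      linarith [(hpotE E hE hEf rfl x).1, (hpotE F hFm hFf hBF x).1]
    have hvu : ∀ x, v x ≤ 2 * u x + κ := fun x => by
      linarith [(hpotE E hE hEf rfl x).2, (hpotE F hFm hFf hBF x).2]
    have h1 : ∫ x in P, v x ≤ ∫ x in H, v x := by
      refine setIntegral_le_setIntegral_of_le_of_ge
        (c := u ((1 - e) • e₀) + u ((1 - e / 2) • e₀))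
        hPm hHm hPf hHf (hvi hPf) (hvi hHf) hPH (fun x hx => ?_) fun x hx => ?_
      · linarith [hvu x, hle (1 - e / 2) (by linarith) x (hPn x hx).1]
      · linarith [hvl x, hge (1 - e) (by linarith) x (hHn x hx).le]
    have h2 : ∫ x in G, v x ≤ ∫ x in Q, v x := by
      refine setIntegral_le_setIntegral_of_le_of_ge
        (c := u ((1 + e / 2) • e₀) + u ((1 + e) • e₀))
        hGm hQm hGf hQf (hvi hGf) (hvi hQf) hQG.symm (fun x hx => ?_) fun x hx => ?_
      · linarith [hvu x, hle (1 + e) (by linarith) x (hGn x hx)]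
      · linarith [hvl x, hge (1 + e / 2) (by linarith) x (hQn x hx).2.le]
    rw [hFdE, hEdF, setIntegral_union hHQ hQm (hvi hHf) (hvi hQf),
      setIntegral_union hGP hPm (hvi hGf) (hvi hPf)]
    linarith
  · exact iInf_volume_real_symmDiff_le hsymm fun x hx =>
      hBF.trans_le (hfar E hE hEf rfl x hx)
  · exact iInf_volume_real_symmDiff_le (fun x hx => (hsymm x hx).symm) fun x hx =>
      hfar F hFm hFf hBF x hx

theorem setIntegral_powerPotential_preimage_add_right (p : ℝ) (E : Set V) (a : V) :
    ∫ x in (fun z => z + a) ⁻¹' E, powerPotential p ((fun z => z + a) ⁻¹' E) x =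
      ∫ x in E, powerPotential p E x := by
  have hmp := measurePreserving_add_right (volume : Measure V) a
  have hme := measurableEmbedding_addRight a
  rw [← hmp.setIntegral_preimage_emb hme (powerPotential p E)]
  congr 1 with x
  unfold powerPotential
  rw [← hmp.setIntegral_preimage_emb hme (fun y => ‖y - (x + a)‖ ^ p)]
  simp

theorem iInf_volume_real_symmDiff_preimage_add_right {E : Set V} (hE : MeasurableSet E) (a : V) :
    ⨅ x : V, volume.real (ball x 1 ∆ ((fun z => z + a) ⁻¹' E)) =
      ⨅ x : V, volume.real (ball x 1 ∆ E) := by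
  refine (Equiv.addRight a).iInf_congr fun x => ?_
  rw [Equiv.coe_addRight,
    ← (measurePreserving_add_right volume a).measureReal_preimage
      (measurableSet_ball.symmDiff hE).nullMeasurableSet,
    Set.preimage_symmDiff, preimage_add_right_ball, add_sub_cancel_right]

end

theorem reduction_to_uniformly_close (N : ℕ) (hN : 2 ≤ N) (α : ℝ) (hα₁ : 1 < α) (hα₂ : α < N)
    (ε : ℝ) (hε₀ : 0 < ε) (hε₁ : ε < 1) :
    ∃ δε : ℝ, 0 < δε ∧ ∀ E : Set (EuclideanSpace ℝ (Fin N)), MeasurableSet E →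
      volume E = volume (ball (0 : EuclideanSpace ℝ (Fin N)) 1) →
      asymmetry N E < δε →
      ∃ E' : Set (EuclideanSpace ℝ (Fin N)), MeasurableSet E' ∧
        volume E' = volume (ball (0 : EuclideanSpace ℝ (Fin N)) 1) ∧
        ball (0 : EuclideanSpace ℝ (Fin N)) (1 - ε ^ 2) ⊆ E' ∧
        E' ⊆ ball (0 : EuclideanSpace ℝ (Fin N)) (1 + ε ^ 2) ∧
        deficit N α E' ≤ deficit N α E ∧
        asymmetry N E' = asymmetry N E := by
  have hfin : Module.finrank ℝ (EuclideanSpace ℝ (Fin N)) = N := by simp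
  have : Nontrivial (EuclideanSpace ℝ (Fin N)) :=
    Module.nontrivial_of_finrank_pos (R := ℝ) (by omega)
  obtain ⟨d, hd, h⟩ := exists_uniformly_close_modification (V := EuclideanSpace ℝ (Fin N))
    (p := α - N) (by rw [hfin]; linarith) (by linarith) (e := ε ^ 2) (by positivity)
    (pow_lt_one₀ hε₀.le hε₁ two_ne_zero)
  refine ⟨d, hd, fun E hE hEv hEa => ?_⟩
  obtain ⟨a, ha⟩ := exists_lt_of_ciInf_lt hEa
  have hmp := measurePreserving_add_right (volume : Measure (EuclideanSpace ℝ (Fin N))) a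
  obtain ⟨F, hF, hFv, hF1, hF2, hF3, hF4⟩ := h ((fun z => z + a) ⁻¹' E)
    (measurable_add_const a hE) ((hmp.measure_preimage hE.nullMeasurableSet).trans hEv) (by
      rw [← sub_self a, ← preimage_add_right_ball, ← Set.preimage_symmDiff,
        hmp.measureReal_preimage (measurableSet_ball.symmDiff hE).nullMeasurableSet]
      exact ha)
  rw [setIntegral_powerPotential_preimage_add_right] at hF3
  rw [iInf_volume_real_symmDiff_preimage_add_right hE] at hF4
  exact ⟨F, hF, hFv, hF1, hF2, sub_le_sub_left hF3 _, hF4⟩
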